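/- Let G be a group and K ≤ G the subgroup generated by all commutators and all squares of elements of G. Let ρ : G → Sp(1) be an irreducible projective representation and χ : G → {±1} a nontrivial homomorphism such that ρ^χ is conjugate to ρ in Sp(1). Then there exists σ ∈ Sp(1) such that σ·ρ(x)·σ⁻¹ ∈ S_i ∪ j·S_i for all x ∈ G, and moreover σ·ρ(k)·σ⁻¹ ∈ S_i for all k ∈ K (so the restriction of ρ to K is abelian after conjugation). -/

import Mathlib

open Quaternion

/-- The quaternion `i`. -/
noncomputable def qi : ℍ[ℝ] := ⟨0, 1, 0, 0⟩

/-- The quaternion `j`. -/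
noncomputable def qj : ℍ[ℝ] := ⟨0, 0, 1, 0⟩

/-- The circle `S_i = {a + b·i : a² + b² = 1}` of unit complex quaternions. -/
noncomputable def Si : Set ℍ[ℝ] := {q | ∃ a b : ℝ, a ^ 2 + b ^ 2 = 1 ∧ q = ⟨a, b, 0, 0⟩}

/-- The translate `j·S_i` of the circle `S_i`. -/
noncomputable def jSi : Set ℍ[ℝ] := {q | ∃ z ∈ Si, q = qj * z}

theorem qi_re : qi.re = 0 := rfl
theorem qi_imI : qi.imI = 1 := rfl
theorem qi_imJ : qi.imJ = 0 := rfl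
theorem qi_imK : qi.imK = 0 := rfl
theorem qj_re : qj.re = 0 := rfl
theorem qj_imI : qj.imI = 0 := rfl
theorem qj_imJ : qj.imJ = 1 := rfl
theorem qj_imK : qj.imK = 0 := rfl

theorem qi_sq : qi * qi = -1 := by
  ext <;> simp [qi_re, qi_imI, qi_imJ, qi_imK]

theorem exists_conj (u : ℍ[ℝ]) (h : u * u = -1) :
    ∃ σ : ℍ[ℝ], ‖σ‖ = 1 ∧ σ * u = qi * σ := by
  have key : ∃ σ : ℍ[ℝ], σ ≠ 0 ∧ σ * u = qi * σ := by
    by_cases h0 : qi + u = 0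
    · refine ⟨qj, ?_, ?_⟩
      · intro h1
        have := congrArg (fun q : ℍ[ℝ] => q.imJ) h1
        simp [qj] at this
      · have : u = -qi := (neg_eq_of_add_eq_zero_right h0).symm
        rw [this]
        ext <;> simp [qi_re, qi_imI, qi_imJ, qi_imK,
          qj_re, qj_imI, qj_imJ, qj_imK]
    · refine ⟨qi + u, h0, ?_⟩
      rw [add_mul, mul_add, h, qi_sq, add_comm]
  obtain ⟨σ, h0, h1⟩ := key
  refine ⟨(‖σ‖⁻¹ : ℝ) • σ, ?_, ?_⟩
  · rw [norm_smul, norm_inv, norm_norm, inv_mul_cancel₀ (norm_ne_zero_iff.mpr h0)]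
  · rw [smul_mul_assoc, h1, mul_smul_comm]

theorem norm_coord (v : ℍ[ℝ]) (hv : ‖v‖ = 1) :
    v.re ^ 2 + v.imI ^ 2 + v.imJ ^ 2 + v.imK ^ 2 = 1 := by
  have := Quaternion.normSq_eq_norm_mul_self v
  rw [hv, Quaternion.normSq_def'] at this
  linarith

theorem mem_Si_of_comm (v : ℍ[ℝ]) (hv : ‖v‖ = 1) (h : qi * v = v * qi) : v ∈ Si := by
  have hn := norm_coord v hv
  have h1 := congrArg (fun q : ℍ[ℝ] => q.imJ) h
  have h2 := congrArg (fun q : ℍ[ℝ] => q.imK) h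
  simp [qi_re, qi_imI, qi_imJ, qi_imK] at h1 h2
  have hJ : v.imJ = 0 := by linarith
  have hK : v.imK = 0 := by linarith
  refine ⟨v.re, v.imI, ?_, ?_⟩
  · rw [hJ, hK] at hn; linarith
  · ext <;> simp [hJ, hK]

theorem mem_jSi_of_anticomm (v : ℍ[ℝ]) (hv : ‖v‖ = 1) (h : qi * v = -(v * qi)) :
    v ∈ jSi := by
  have hn := norm_coord v hv
  have h1 := congrArg (fun q : ℍ[ℝ] => q.re) h
  have h2 := congrArg (fun q : ℍ[ℝ] => q.imI) h
  simp [qi_re, qi_imI, qi_imJ, qi_imK] at h1 h2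
  have hR : v.re = 0 := by linarith
  have hI : v.imI = 0 := by linarith
  obtain ⟨z, hz, z1, z2, z3, z4⟩ : ∃ z : ℍ[ℝ], z = ⟨v.imJ, -v.imK, 0, 0⟩ ∧ z.re = v.imJ ∧
      z.imI = -v.imK ∧ z.imJ = 0 ∧ z.imK = 0 := ⟨_, rfl, rfl, rfl, rfl, rfl⟩
  refine ⟨z, ⟨v.imJ, -v.imK, ?_, hz⟩, ?_⟩
  · rw [hR, hI] at hn; linarith
  · ext <;> simp [qj_re, qj_imI, qj_imJ, qj_imK, hR, hI, z1, z2, z3, z4]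

/-- Let `K ≤ G` be the subgroup generated by all commutators and all squares.  If
`ρ : G → Sp(1)` is an irreducible projective representation and `χ : G → {±1}` is a
nontrivial homomorphism with `ρ^χ` conjugate to `ρ`, then after conjugation by some
`σ ∈ Sp(1)` the image of `ρ` lies in `S_i ∪ j·S_i`, and the image of `K` lies in `S_i`. -/
theorem image_in_binary_dihedral {G : Type*} [Group G]
    (K : Subgroup G)
    (hK : K = Subgroup.closure
      ({x : G | ∃ g h : G, x = g * h * g⁻¹ * h⁻¹} ∪ {x : G | ∃ g : G, x = g ^ 2}))
    (ρ : G → ℍ[ℝ]) (hρ : ∀ g, ‖ρ g‖ = 1)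
    (hpr : ∀ g h : G, ρ (g * h) * (ρ h)⁻¹ * (ρ g)⁻¹ = 1 ∨
      ρ (g * h) * (ρ h)⁻¹ * (ρ g)⁻¹ = -1)
    (hirr : ∀ z : ℍ[ℝ], ‖z‖ = 1 → (∀ x : G, z * ρ x = ρ x * z) → z = 1 ∨ z = -1)
    (χ : G → ℍ[ℝ]) (hχ : ∀ x, χ x = 1 ∨ χ x = -1)
    (hχhom : ∀ x y : G, χ (x * y) = χ x * χ y)
    (hχnt : ∃ x : G, χ x ≠ 1)
    (u : ℍ[ℝ]) (hu : ‖u‖ = 1)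
    (hconj : ∀ x : G, χ x * ρ x = u * ρ x * u⁻¹) :
    ∃ σ : ℍ[ℝ], ‖σ‖ = 1 ∧ (∀ x : G, σ * ρ x * σ⁻¹ ∈ Si ∪ jSi) ∧
      ∀ k : G, k ∈ K → σ * ρ k * σ⁻¹ ∈ Si := by
  have hu0 : u ≠ 0 := norm_ne_zero_iff.mp (by rw [hu]; exact one_ne_zero)
  have hc : ∀ x, u * ρ x = χ x * ρ x * u := fun x => by
    rw [hconj x, inv_mul_cancel_right₀ hu0]
  have hsq : u * u = -1 := by
    have h := hirr (u * u) (by rw [norm_mul, hu, one_mul]) (fun x => by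
      have h := hc x
      rcases hχ x with h1 | h1 <;> rw [h1] at h
      · rw [one_mul] at h
        rw [mul_assoc, h, ← mul_assoc, h, mul_assoc]
      · rw [neg_one_mul, neg_mul] at h
        rw [mul_assoc, h, mul_neg, ← mul_assoc, h, neg_mul, neg_neg, mul_assoc])
    refine h.resolve_left fun h => ?_
    obtain ⟨x, hx⟩ := hχnt
    apply hx
    have hx0 : ρ x ≠ 0 := norm_ne_zero_iff.mp (by rw [hρ]; exact one_ne_zero)
    have h3 := hconj x
    have h4 : u * ρ x * u⁻¹ = ρ x := by
      rcases mul_self_eq_one_iff.mp h with h | h <;> rw [h] <;> simp [inv_neg]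
    rw [h4] at h3
    exact (mul_eq_right₀ hx0).mp h3
  obtain ⟨σ, hσ, hσu⟩ := exists_conj u hsq
  have hσ0 : σ ≠ 0 := norm_ne_zero_iff.mp (by rw [hσ]; exact one_ne_zero)
  have hn : ∀ x, ‖σ * ρ x * σ⁻¹‖ = 1 := fun x => by
    rw [norm_mul, norm_mul, norm_inv, hσ, hρ]; norm_num
  have hi : qi = σ * u * σ⁻¹ := by rw [hσu, mul_inv_cancel_right₀ hσ0]
  have e1 : ∀ a b : ℍ[ℝ], (σ * a * σ⁻¹) * (σ * b * σ⁻¹) = σ * (a * b) * σ⁻¹ := fun a b => by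
    simp only [mul_assoc, inv_mul_cancel_left₀ hσ0]
  have hS : ∀ x, χ x = 1 → σ * ρ x * σ⁻¹ ∈ Si := fun x hx => by
    refine mem_Si_of_comm _ (hn x) ?_
    rw [hi, e1, e1, hc x, hx, one_mul]
  refine ⟨σ, hσ, fun x => ?_, fun k hk => hS k ?_⟩
  · rcases hχ x with hx | hx
    · exact Or.inl (hS x hx)
    · refine Or.inr (mem_jSi_of_anticomm _ (hn x) ?_)
      rw [hi, e1, e1, hc x, hx, neg_one_mul, neg_mul, mul_neg, neg_mul]
  · have hone : χ 1 = 1 := by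
      have h := hχhom 1 1
      rw [mul_one] at h
      rcases hχ 1 with h1 | h1
      · exact h1
      · rw [h1] at h ⊢; simpa using h
    have hinv : ∀ x, χ x⁻¹ = χ x := fun x => by
      have h := hχhom x x⁻¹
      rw [mul_inv_cancel, hone] at h
      rcases hχ x with h1 | h1 <;> rw [h1] at h ⊢
      · rw [h, one_mul]
      · rw [h]; simp
    rw [hK] at hk
    induction hk using Subgroup.closure_induction with
    | mem x hx =>
      rcases hx with ⟨g, h, rfl⟩ | ⟨g, rfl⟩
      · simp only [hχhom, hinv]
        rcases hχ g with h1 | h1 <;> rcases hχ h with h2 | h2 <;> rw [h1, h2] <;> simp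
      · rw [pow_two, hχhom]
        rcases hχ g with h1 | h1 <;> rw [h1] <;> simp
    | one => exact hone
    | mul x y _ _ hx hy => rw [hχhom, hx, hy, one_mul]
    | inv x _ hx => rw [hinv, hx]
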